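/- arXiv:0712.2328 — 7 statements merged into one kernel-verified Lean document; each statement's English description precedes it below -/
import Mathlib

section
/- Let E be a real inner product space, F : E →ₗ[ℝ] E a linear map satisfying ⟨F x, y⟩ = −⟨x, F y⟩ for all x, y ∈ E, let k ∈ ℕ, α_0, …, α_k ∈ ℝ, t ∈ ℝ and x ∈ E. Then ‖Σ_{i=0}^{k} α_i t^i F^[i] x‖² = Σ_{ℓ=0}^{k} S_ℓ t^{2ℓ} ‖F^[ℓ] x‖², where S_ℓ = Σ_{j=−min(ℓ,k−ℓ)}^{min(ℓ,k−ℓ)} (−1)^j α_{ℓ−j} α_{ℓ+j}. -/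
open RealInnerProductSpace

section SkewAdjoint

variable {E : Type*} [NormedAddCommGroup E] [InnerProductSpace ℝ E] {F : E → E}

theorem inner_iterate_add_of_skewAdjoint (hF : ∀ x y : E, ⟪F x, y⟫ = -⟪x, F y⟫)
    (a n b : ℕ) (x : E) :
    ⟪F^[a + n] x, F^[b] x⟫ = (-1 : ℝ) ^ n * ⟪F^[a] x, F^[b + n] x⟫ := by
  induction n generalizing b with
  | zero => simp
  | succ n ih =>
    rw [← add_assoc a, Function.iterate_succ_apply', hF, ← Function.iterate_succ_apply' F b, ih,
      Nat.succ_add_eq_add_succ, pow_succ]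
    ring

theorem inner_iterate_of_skewAdjoint_of_even (hF : ∀ x y : E, ⟪F x, y⟫ = -⟪x, F y⟫)
    {a b l : ℕ} (h : a + b = 2 * l) (x : E) :
    ⟪F^[a] x, F^[b] x⟫ = (-1 : ℝ) ^ (l + b) * ‖F^[l] x‖ ^ 2 := by
  rcases le_total l a with hla | hla
  · obtain ⟨n, rfl⟩ := Nat.exists_eq_add_of_le hla
    obtain rfl : l = b + n := by omega
    rw [inner_iterate_add_of_skewAdjoint hF, real_inner_self_eq_norm_sq,
      show b + n + b = 2 * b + n by ring, pow_add, pow_mul]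
    simp
  · obtain ⟨n, rfl⟩ : ∃ n, b = l + n := Nat.exists_eq_add_of_le (by omega)
    obtain rfl : l = a + n := by omega
    rw [real_inner_comm, inner_iterate_add_of_skewAdjoint hF, real_inner_self_eq_norm_sq,
      show a + n + (a + n + n) = 2 * (a + n) + n by ring, pow_add _ _ n, pow_mul]
    simp

theorem inner_iterate_of_skewAdjoint_of_odd (hF : ∀ x y : E, ⟪F x, y⟫ = -⟪x, F y⟫)
    {a b : ℕ} (h : Odd (a + b)) (x : E) : ⟪F^[a] x, F^[b] x⟫ = 0 := by
  have hself (y : E) : ⟪F y, y⟫ = 0 := by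
    have := hF y y
    rw [real_inner_comm (F y) y] at this
    linarith
  obtain ⟨l, hl⟩ := h
  rcases le_total b l with hbl | hbl
  · obtain ⟨n, rfl⟩ := Nat.exists_eq_add_of_le hbl
    obtain rfl : a = b + n + 1 + n := by omega
    rw [inner_iterate_add_of_skewAdjoint hF, Function.iterate_succ_apply', hself, mul_zero]
  · obtain ⟨n, rfl⟩ := Nat.exists_eq_add_of_le hbl
    obtain rfl | ⟨m, rfl⟩ : n = 0 ∨ ∃ m, n = m + 1 := by cases n <;> simp
    · obtain rfl : a = l + 1 := by omega
      rw [add_zero, Function.iterate_succ_apply', hself]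
    · obtain rfl : l = a + m := by omega
      rw [real_inner_comm, show a + m + (m + 1) = a + m + 1 + m by ring,
        inner_iterate_add_of_skewAdjoint hF, Function.iterate_succ_apply', hself, mul_zero]

end SkewAdjoint

/-- Identity (9)–(10) of the paper: the squared norm of a polynomial in a
skew-adjoint operator applied to `x`, expressed via the amplification
coefficients `S_ℓ`. -/
theorem norm_sq_poly_skewAdjoint
    {E : Type*} [NormedAddCommGroup E] [InnerProductSpace ℝ E]
    (F : E →ₗ[ℝ] E) (hF : ∀ x y : E, ⟪F x, y⟫ = -⟪x, F y⟫)
    (k : ℕ) (α : ℕ → ℝ) (t : ℝ) (x : E)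
    (S : ℕ → ℝ)
    (hS : ∀ ℓ : ℕ, S ℓ = ∑ j ∈ Finset.Icc (-(min ℓ (k - ℓ) : ℤ)) (min ℓ (k - ℓ) : ℤ),
      (-1 : ℝ) ^ j * α ((ℓ : ℤ) - j).toNat * α ((ℓ : ℤ) + j).toNat) :
    ‖∑ i ∈ Finset.range (k + 1), (α i * t ^ i) • (⇑F)^[i] x‖ ^ 2
      = ∑ ℓ ∈ Finset.range (k + 1), S ℓ * t ^ (2 * ℓ) * ‖(⇑F)^[ℓ] x‖ ^ 2 := by
  have hexpand : ‖∑ i ∈ Finset.range (k + 1), (α i * t ^ i) • (⇑F)^[i] x‖ ^ 2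
      = ∑ p ∈ Finset.range (k + 1) ×ˢ Finset.range (k + 1),
        α p.1 * α p.2 * t ^ (p.1 + p.2) * ⟪F^[p.1] x, F^[p.2] x⟫ := by
    rw [← real_inner_self_eq_norm_sq, sum_inner, Finset.sum_product]
    refine Finset.sum_congr rfl fun i _ => ?_
    rw [inner_sum]
    refine Finset.sum_congr rfl fun j _ => ?_
    rw [real_inner_smul_left, real_inner_smul_right]
    ring
  have hodd : ∀ p ∈ Finset.range (k + 1) ×ˢ Finset.range (k + 1),
      α p.1 * α p.2 * t ^ (p.1 + p.2) * ⟪F^[p.1] x, F^[p.2] x⟫ ≠ 0 → Even (p.1 + p.2) := by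
    intro p _ hp
    by_contra h
    exact hp (by rw [inner_iterate_of_skewAdjoint_of_odd hF (Nat.not_even_iff_odd.mp h), mul_zero])
  rw [hexpand, ← Finset.sum_filter_of_ne hodd]
  simp_rw [hS, Finset.sum_mul]
  rw [Finset.sum_sigma']
  refine Finset.sum_bij' (fun p _ => ⟨(p.1 + p.2) / 2, (p.2 : ℤ) - ((p.1 + p.2) / 2 : ℕ)⟩)
    (fun q _ => (((q.1 : ℤ) - q.2).toNat, ((q.1 : ℤ) + q.2).toNat)) ?_ ?_ ?_ ?_ ?_
  · rintro ⟨a, b⟩ h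
    simp only [Finset.mem_filter, Finset.mem_product, Finset.mem_range, Finset.mem_sigma,
      Finset.mem_Icc, even_iff_two_dvd] at h ⊢
    omega
  · rintro ⟨l, j⟩ h
    simp only [Finset.mem_filter, Finset.mem_product, Finset.mem_range, Finset.mem_sigma,
      Finset.mem_Icc, even_iff_two_dvd] at h ⊢
    omega
  · rintro ⟨a, b⟩ h
    simp only [Finset.mem_filter, even_iff_two_dvd] at h
    ext <;> dsimp only <;> omega
  · rintro ⟨l, j⟩ h
    simp only [Finset.mem_sigma, Finset.mem_Icc] at h
    have hl : (((l : ℤ) - j).toNat + ((l : ℤ) + j).toNat) / 2 = l := by omega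
    have hj : (((l : ℤ) + j).toNat : ℤ) - l = j := by omega
    simp only [hl, hj]
  · rintro ⟨a, b⟩ h
    obtain ⟨l, hl⟩ := (Finset.mem_filter.mp h).2
    dsimp only at hl ⊢
    have hl2 : (a + b) / 2 = l := by omega
    have ha : ((l : ℤ) - (b - l)).toNat = a := by omega
    have hb : ((l : ℤ) + (b - l)).toNat = b := by omega
    have hsign : (-1 : ℝ) ^ ((b : ℤ) - l) = (-1) ^ (l + b) := by
      rw [show (b : ℤ) - l = (l + b : ℕ) - 2 * l by push_cast; ring, zpow_sub₀ (by norm_num),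
        zpow_natCast, zpow_mul]
      simp
    rw [hl2, ha, hb, hsign, inner_iterate_of_skewAdjoint_of_even hF (hl.trans (two_mul l).symm),
      hl, two_mul]
    ring
end

section
/- Let E be a real inner product space, F : E →ₗ[ℝ] E a linear map satisfying ⟨F x, y⟩ = −⟨x, F y⟩ for all x, y ∈ E, let p ≥ 1 be an integer, t ∈ ℝ and x ∈ E. Then ‖Σ_{i=0}^{2p} (t^i / i!) F^[i] x‖² = ‖x‖² + Σ_{ℓ=p+1}^{2p} S_ℓ t^{2ℓ} ‖F^[ℓ] x‖², where S_ℓ = Σ_{j=−(2p−ℓ)}^{2p−ℓ} (−1)^j / ((ℓ−j)! · (ℓ+j)!). In particular all the amplification coefficients S_ℓ with 1 ≤ ℓ ≤ p vanish. -/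
open RealInnerProductSpace

theorem inner_iterate_iterate_of_skewAdjoint
    {E : Type*} [NormedAddCommGroup E] [InnerProductSpace ℝ E]
    {F : E →ₗ[ℝ] E} (hF : ∀ x y : E, ⟪F x, y⟫ = -⟪x, F y⟫) (i m : ℕ) (x y : E) :
    ⟪(⇑F)^[i] x, (⇑F)^[m] y⟫ = (-1) ^ i * ⟪x, (⇑F)^[i + m] y⟫ := by
  induction i generalizing m with
  | zero => simp
  | succ i ih =>
    rw [Function.iterate_succ_apply', hF, ← Function.iterate_succ_apply' (⇑F) m, ih,
      show i + m.succ = i + 1 + m by omega]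
    ring

theorem inner_iterate_two_mul_of_skewAdjoint
    {E : Type*} [NormedAddCommGroup E] [InnerProductSpace ℝ E]
    {F : E →ₗ[ℝ] E} (hF : ∀ x y : E, ⟪F x, y⟫ = -⟪x, F y⟫) (l : ℕ) (x : E) :
    ⟪x, (⇑F)^[2 * l] x⟫ = (-1) ^ l * ‖(⇑F)^[l] x‖ ^ 2 := by
  rw [← real_inner_self_eq_norm_sq, inner_iterate_iterate_of_skewAdjoint hF, ← mul_assoc,
    ← mul_pow, two_mul]
  simp

theorem inner_iterate_odd_of_skewAdjoint
    {E : Type*} [NormedAddCommGroup E] [InnerProductSpace ℝ E]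
    {F : E →ₗ[ℝ] E} (hF : ∀ x y : E, ⟪F x, y⟫ = -⟪x, F y⟫) {n : ℕ} (hn : Odd n) (x : E) :
    ⟪x, (⇑F)^[n] x⟫ = 0 := by
  have h := inner_iterate_iterate_of_skewAdjoint hF n 0 x x
  rw [hn.neg_one_pow, Function.iterate_zero_apply, add_zero, real_inner_comm] at h
  linarith

theorem sum_antidiagonal_neg_one_pow_div_factorial {n : ℕ} (hn : n ≠ 0) :
    ∑ q ∈ Finset.HasAntidiagonal.antidiagonal n,
      (-1 : ℝ) ^ q.1 / ((q.1.factorial : ℝ) * (q.2.factorial : ℝ)) = 0 := by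
  have h := (Commute.all (-1 : ℝ) 1).add_pow' n
  rw [neg_add_cancel, zero_pow hn] at h
  rw [← zero_div (n.factorial : ℝ), h, Finset.sum_div]
  refine Finset.sum_congr rfl fun q hq => ?_
  obtain rfl := Finset.HasAntidiagonal.mem_antidiagonal.1 hq
  have h2 : ((q.1 + q.2).choose q.1 : ℝ) * q.1.factorial * q.2.factorial
      = (q.1 + q.2).factorial := by
    rw [Nat.choose_symm_add]
    exact_mod_cast Nat.add_choose_mul_factorial_mul_factorial q.1 q.2
  rw [nsmul_eq_mul, one_pow, mul_one, ← h2]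
  have := Nat.cast_ne_zero (R := ℝ).2 (Nat.choose_pos (Nat.le_add_right q.1 q.2)).ne'
  field_simp

theorem sum_range_two_mul_succ_of_odd_eq_zero {M : Type*} [AddCommMonoid M] {f : ℕ → M}
    (hf : ∀ n, Odd n → f n = 0) (N : ℕ) :
    ∑ n ∈ Finset.range (2 * N + 1), f n = ∑ l ∈ Finset.range (N + 1), f (2 * l) := by
  induction N with
  | zero => simp
  | succ N ih =>
    rw [Finset.sum_range_succ _ (N + 1), ← ih, show 2 * (N + 1) + 1 = 2 * N + 1 + 1 + 1 by ring,
      Finset.sum_range_succ, Finset.sum_range_succ, hf (2 * N + 1) ⟨N, rfl⟩, add_zero]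
    rfl

theorem norm_sq_sum_smul_iterate_of_skewAdjoint
    {E : Type*} [NormedAddCommGroup E] [InnerProductSpace ℝ E]
    {F : E →ₗ[ℝ] E} (hF : ∀ x y : E, ⟪F x, y⟫ = -⟪x, F y⟫) (k : ℕ) (a : ℕ → ℝ) (x : E) :
    ‖∑ i ∈ Finset.range (k + 1), a i • (⇑F)^[i] x‖ ^ 2
      = ∑ l ∈ Finset.range (k + 1),
          (-1) ^ l * (∑ q ∈ Finset.range (k + 1) ×ˢ Finset.range (k + 1) with q.1 + q.2 = 2 * l,
            (-1) ^ q.1 * a q.1 * a q.2) * ‖(⇑F)^[l] x‖ ^ 2 := by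
  calc
    _ = ∑ q ∈ Finset.range (k + 1) ×ˢ Finset.range (k + 1),
          (-1) ^ q.1 * a q.1 * a q.2 * ⟪x, (⇑F)^[q.1 + q.2] x⟫ := by
      rw [← real_inner_self_eq_norm_sq, sum_inner, Finset.sum_product]
      refine Finset.sum_congr rfl fun i _ => ?_
      rw [inner_sum]
      refine Finset.sum_congr rfl fun m _ => ?_
      rw [real_inner_smul_left, real_inner_smul_right,
        inner_iterate_iterate_of_skewAdjoint hF]
      ring
    _ = ∑ n ∈ Finset.range (2 * k + 1),
          (∑ q ∈ Finset.range (k + 1) ×ˢ Finset.range (k + 1) with q.1 + q.2 = n,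
            (-1) ^ q.1 * a q.1 * a q.2) * ⟪x, (⇑F)^[n] x⟫ := by
      rw [← Finset.sum_fiberwise_of_maps_to (g := fun q : ℕ × ℕ => q.1 + q.2)
        (t := Finset.range (2 * k + 1))]
      · refine Finset.sum_congr rfl fun n _ => ?_
        rw [Finset.sum_mul]
        refine Finset.sum_congr rfl fun q hq => ?_
        rw [(Finset.mem_filter.1 hq).2]
      · intro q hq
        simp only [Finset.mem_product, Finset.mem_range] at hq ⊢
        omega
    _ = _ := by
      rw [sum_range_two_mul_succ_of_odd_eq_zero
        fun n hn => by rw [inner_iterate_odd_of_skewAdjoint hF hn, mul_zero]]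
      refine Finset.sum_congr rfl fun l _ => ?_
      rw [inner_iterate_two_mul_of_skewAdjoint hF]
      ring

theorem sum_Icc_neg_one_zpow_div_factorial {k l : ℕ} (hl : l ≤ k) :
    ∑ j ∈ Finset.Icc (-(min l (k - l) : ℤ)) (min l (k - l) : ℤ),
      (-1 : ℝ) ^ j / ((((l : ℤ) - j).toNat.factorial : ℝ) * (((l : ℤ) + j).toNat.factorial : ℝ))
      = (-1) ^ l * ∑ q ∈ Finset.range (k + 1) ×ˢ Finset.range (k + 1) with q.1 + q.2 = 2 * l,
          (-1 : ℝ) ^ q.1 / ((q.1.factorial : ℝ) * (q.2.factorial : ℝ)) := by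
  rw [Finset.mul_sum]
  refine Finset.sum_nbij' (fun j => (((l : ℤ) - j).toNat, ((l : ℤ) + j).toNat))
    (fun q => (l : ℤ) - q.1) ?_ ?_ ?_ ?_ ?_
  · intro j hj
    simp only [Finset.mem_Icc, Finset.mem_filter, Finset.mem_product, Finset.mem_range] at hj ⊢
    omega
  · intro q hq
    simp only [Finset.mem_Icc, Finset.mem_filter, Finset.mem_product, Finset.mem_range] at hq ⊢
    omega
  · intro j hj
    simp only [Finset.mem_Icc] at hj ⊢
    omega
  · intro q hq
    simp only [Finset.mem_filter, Finset.mem_product, Finset.mem_range] at hq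
    ext <;> dsimp only <;> omega
  · intro j hj
    simp only [Finset.mem_Icc] at hj
    obtain ⟨i, hi⟩ : ∃ i : ℕ, (l : ℤ) - j = i := ⟨((l : ℤ) - j).toNat, by omega⟩
    have hsign : (-1 : ℝ) ^ j = (-1) ^ l * (-1) ^ i := by
      rw [show j = (l : ℤ) - i by omega, zpow_sub₀ (by norm_num), zpow_natCast, zpow_natCast,
        div_eq_mul_inv, ← inv_pow, inv_neg_one]
    dsimp only
    rw [hsign, hi, Int.toNat_natCast, mul_div_assoc]

/-- Norm identity underlying Theorem 1 of the paper: for a skew-adjoint `F`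
and the Taylor coefficients `α_i = 1/i!` (k = 2p), the amplification
coefficients `S_ℓ` vanish for `1 ≤ ℓ ≤ p` and
`‖∑_{i=0}^{2p} (t^i/i!) F^[i] x‖² = ‖x‖² + ∑_{ℓ=p+1}^{2p} S_ℓ t^{2ℓ} ‖F^[ℓ] x‖²`. -/
theorem norm_sq_taylor_skewAdjoint
    {E : Type*} [NormedAddCommGroup E] [InnerProductSpace ℝ E]
    (F : E →ₗ[ℝ] E) (hF : ∀ x y : E, ⟪F x, y⟫ = -⟪x, F y⟫)
    (p : ℕ) (hp : 1 ≤ p) (t : ℝ) (x : E)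
    (S : ℕ → ℝ)
    (hS : ∀ ℓ : ℕ, S ℓ = ∑ j ∈ Finset.Icc (-(min ℓ (2 * p - ℓ) : ℤ)) (min ℓ (2 * p - ℓ) : ℤ),
      (-1 : ℝ) ^ j / ((((ℓ : ℤ) - j).toNat.factorial : ℝ) * (((ℓ : ℤ) + j).toNat.factorial : ℝ))) :
    ‖∑ i ∈ Finset.range (2 * p + 1), (t ^ i / (i.factorial : ℝ)) • (⇑F)^[i] x‖ ^ 2
        = ‖x‖ ^ 2 + ∑ ℓ ∈ Finset.Icc (p + 1) (2 * p), S ℓ * t ^ (2 * ℓ) * ‖(⇑F)^[ℓ] x‖ ^ 2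
      ∧ ∀ ℓ ∈ Finset.Icc 1 p, S ℓ = 0 := by
  have hST : ∀ l ≤ 2 * p, S l = (-1) ^ l *
      ∑ q ∈ Finset.range (2 * p + 1) ×ˢ Finset.range (2 * p + 1) with q.1 + q.2 = 2 * l,
        (-1 : ℝ) ^ q.1 / ((q.1.factorial : ℝ) * (q.2.factorial : ℝ)) := by
    intro l hl
    rw [hS, ← sum_Icc_neg_one_zpow_div_factorial hl, Nat.cast_mul, Nat.cast_two]
  have hzero : ∀ l ∈ Finset.Icc 1 p, S l = 0 := by
    intro l hl
    rw [Finset.mem_Icc] at hl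
    rw [hST l (by omega)]
    convert mul_zero ((-1 : ℝ) ^ l)
    rw [← sum_antidiagonal_neg_one_pow_div_factorial (n := 2 * l) (by omega)]
    congr 1
    ext q
    simp only [Finset.mem_filter, Finset.mem_product, Finset.mem_range,
      Finset.HasAntidiagonal.mem_antidiagonal]
    omega
  refine ⟨?_, hzero⟩
  have hS0 : S 0 = 1 := by simp [hS]
  calc
    _ = ∑ l ∈ Finset.range (2 * p + 1), S l * t ^ (2 * l) * ‖(⇑F)^[l] x‖ ^ 2 := by
      rw [norm_sq_sum_smul_iterate_of_skewAdjoint hF]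
      refine Finset.sum_congr rfl fun l hl => ?_
      rw [hST l (by rw [Finset.mem_range] at hl; omega), mul_assoc _ _ (t ^ (2 * l)),
        Finset.sum_mul]
      congr 2
      refine Finset.sum_congr rfl fun q hq => ?_
      rw [← (Finset.mem_filter.1 hq).2, pow_add]
      field_simp
    _ = ∑ l ∈ insert 0 (Finset.Icc (p + 1) (2 * p)),
          S l * t ^ (2 * l) * ‖(⇑F)^[l] x‖ ^ 2 := by
      symm
      apply Finset.sum_subset
      · intro l hl
        simp only [Finset.mem_insert, Finset.mem_Icc, Finset.mem_range] at hl ⊢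
        omega
      · intro l hl hl'
        simp only [Finset.mem_insert, Finset.mem_Icc, Finset.mem_range] at hl hl'
        rw [hzero l (Finset.mem_Icc.2 (by omega)), zero_mul, zero_mul]
    _ = _ := by
      rw [Finset.sum_insert (by simp), hS0]
      simp
end

section
/- Let E be a real inner product space, F : E →ₗ[ℝ] E a linear map satisfying ⟨F x, y⟩ = −⟨x, F y⟩ for all x, y ∈ E, and assume ‖F x‖ ≤ M ‖x‖ for all x ∈ E, where M ≥ 0. Let k ∈ ℕ, α_0, …, α_k ∈ ℝ, and define S_ℓ = Σ_{j=−min(ℓ,k−ℓ)}^{min(ℓ,k−ℓ)} (−1)^j α_{ℓ−j} α_{ℓ+j} for 0 ≤ ℓ ≤ k. Suppose S_0 = 1 and, for some integer r with 1 ≤ r ≤ k, S_ℓ = 0 for all 1 ≤ ℓ ≤ r−1. Then for every t ≥ 0 with t·M ≤ 1 and every x ∈ E, ‖Σ_{i=0}^{k} α_i t^i F^[i] x‖ ≤ (1 + K (tM)^{2r}) ‖x‖, where K = (1/2) Σ_{ℓ=r}^{k} |S_ℓ|. -/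
open RealInnerProductSpace

/-- Iterates of a skew-adjoint map move across the inner product up to sign. -/
theorem inner_iterate_add_left_of_skew {E : Type*} [NormedAddCommGroup E] [InnerProductSpace ℝ E]
    {F : E → E} (hF : ∀ x y : E, ⟪F x, y⟫ = -⟪x, F y⟫) (m n d : ℕ) (x : E) :
    ⟪F^[m + d] x, F^[n] x⟫ = (-1 : ℝ) ^ d * ⟪F^[m] x, F^[n + d] x⟫ := by
  induction d generalizing n with
  | zero => simp
  | succ d ih =>
    rw [← add_assoc, Function.iterate_succ_apply', hF, ← Function.iterate_succ_apply' F n, ih,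
      pow_succ, show n.succ + d = n + (d + 1) by omega]
    ring

theorem inner_iterate_eq_zero_of_skew {E : Type*} [NormedAddCommGroup E] [InnerProductSpace ℝ E]
    {F : E → E} (hF : ∀ x y : E, ⟪F x, y⟫ = -⟪x, F y⟫) {m n : ℕ} (h : ¬ Even (m + n)) (x : E) :
    ⟪F^[m] x, F^[n] x⟫ = 0 := by
  wlog hmn : n ≤ m generalizing m n
  · rw [real_inner_comm]
    exact this (by rwa [add_comm]) (by omega)
  obtain ⟨d, rfl⟩ := Nat.exists_eq_add_of_le hmn
  have hd : Odd d := by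
    rw [Nat.not_even_iff_odd] at h
    grind
  have key := inner_iterate_add_left_of_skew hF n n d x
  rw [hd.neg_one_pow, real_inner_comm (F^[n + d] x)] at key
  linarith

theorem inner_iterate_sub_add_of_skew {E : Type*} [NormedAddCommGroup E] [InnerProductSpace ℝ E]
    {F : E → E} (hF : ∀ x y : E, ⟪F x, y⟫ = -⟪x, F y⟫) {l : ℕ} {j : ℤ}
    (h₁ : -(l : ℤ) ≤ j) (h₂ : j ≤ l) (x : E) :
    ⟪F^[((l : ℤ) - j).toNat] x, F^[((l : ℤ) + j).toNat] x⟫ = (-1 : ℝ) ^ j * ‖F^[l] x‖ ^ 2 := by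
  have key (d : ℕ) (hd : d ≤ l) :
      ⟪F^[l + d] x, F^[l - d] x⟫ = (-1 : ℝ) ^ d * ‖F^[l] x‖ ^ 2 := by
    rw [inner_iterate_add_left_of_skew hF, Nat.sub_add_cancel hd, real_inner_self_eq_norm_sq]
  obtain ⟨d, rfl | rfl⟩ := j.eq_nat_or_neg
  · rw [show ((l : ℤ) - d).toNat = l - d by omega, show ((l : ℤ) + d).toNat = l + d by omega,
      real_inner_comm, key d (by omega), zpow_natCast]
  · rw [show ((l : ℤ) - -d).toNat = l + d by omega, show ((l : ℤ) + -d).toNat = l - d by omega,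
      key d (by omega), zpow_neg, zpow_natCast, ← inv_pow, inv_neg_one]

/-- Group a sum over a square of indices with even index sum by the half-sum of the indices. -/
theorem sum_range_product_eq_sum_Icc {A : Type*} [AddCommMonoid A] (k : ℕ) (f : ℕ → ℕ → A)
    (hf : ∀ i j, ¬ Even (i + j) → f i j = 0) :
    ∑ i ∈ Finset.range (k + 1), ∑ j ∈ Finset.range (k + 1), f i j =
      ∑ l ∈ Finset.range (k + 1),
        ∑ j ∈ Finset.Icc (-(min l (k - l) : ℤ)) (min l (k - l) : ℤ),
          f ((l : ℤ) - j).toNat ((l : ℤ) + j).toNat := by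
  rw [← Finset.sum_product', ← Finset.sum_filter_of_ne (p := fun p : ℕ × ℕ => Even (p.1 + p.2))
    (fun p _ hp => not_imp_comm.1 (hf p.1 p.2) hp),
    ← Finset.sum_fiberwise_of_maps_to (g := fun p : ℕ × ℕ => (p.1 + p.2) / 2)
      (t := Finset.range (k + 1))
      (by
        intro p hp
        simp only [Finset.mem_filter, Finset.mem_product, Finset.mem_range] at hp ⊢
        omega)]
  refine Finset.sum_congr rfl fun l _ => ?_
  refine Finset.sum_nbij' (fun p => (p.2 : ℤ) - l)
    (fun j => (((l : ℤ) - j).toNat, ((l : ℤ) + j).toNat)) ?_ ?_ ?_ ?_ ?_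
  · rintro ⟨a, b⟩ hp
    simp only [Finset.mem_filter, Finset.mem_product, Finset.mem_range, Finset.mem_Icc,
      Nat.even_iff] at hp ⊢
    omega
  · intro j hj
    simp only [Finset.mem_filter, Finset.mem_product, Finset.mem_range, Finset.mem_Icc,
      Nat.even_iff] at hj ⊢
    omega
  · rintro ⟨a, b⟩ hp
    simp only [Finset.mem_filter, Finset.mem_product, Finset.mem_range, Nat.even_iff,
      Prod.mk.injEq] at hp ⊢
    omega
  · intro j hj
    simp only [Finset.mem_Icc] at hj ⊢
    omega
  · rintro ⟨a, b⟩ hp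
    simp only [Finset.mem_filter, Finset.mem_product, Finset.mem_range, Nat.even_iff] at hp ⊢
    congr 1 <;> omega

theorem norm_sq_sum_smul_iterate_of_skew {E : Type*} [NormedAddCommGroup E]
    [InnerProductSpace ℝ E] {F : E → E} (hF : ∀ x y : E, ⟪F x, y⟫ = -⟪x, F y⟫)
    (k : ℕ) (α : ℕ → ℝ) (t : ℝ) (x : E) :
    ‖∑ i ∈ Finset.range (k + 1), (α i * t ^ i) • F^[i] x‖ ^ 2 =
      ∑ l ∈ Finset.range (k + 1),
        (∑ j ∈ Finset.Icc (-(min l (k - l) : ℤ)) (min l (k - l) : ℤ),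
          (-1 : ℝ) ^ j * α ((l : ℤ) - j).toNat * α ((l : ℤ) + j).toNat) *
            (t ^ (2 * l) * ‖F^[l] x‖ ^ 2) := by
  rw [← real_inner_self_eq_norm_sq, sum_inner]
  simp only [inner_sum, real_inner_smul_left, real_inner_smul_right]
  rw [sum_range_product_eq_sum_Icc k
    (fun i j => α j * t ^ j * (α i * t ^ i * ⟪F^[i] x, F^[j] x⟫))
    (fun i j h => by simp [inner_iterate_eq_zero_of_skew hF h])]
  refine Finset.sum_congr rfl fun l _ => ?_
  rw [Finset.sum_mul]
  refine Finset.sum_congr rfl fun j hj => ?_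
  rw [Finset.mem_Icc] at hj
  rw [inner_iterate_sub_add_of_skew hF (by omega) (by omega),
    show 2 * l = ((l : ℤ) - j).toNat + ((l : ℤ) + j).toNat by omega, pow_add]
  ring

theorem norm_iterate_le_pow_mul {E : Type*} [NormedAddCommGroup E] {F : E → E} {M : ℝ}
    (hM : 0 ≤ M) (hFM : ∀ x : E, ‖F x‖ ≤ M * ‖x‖) (n : ℕ) (x : E) :
    ‖F^[n] x‖ ≤ M ^ n * ‖x‖ := by
  induction n with
  | zero => simp
  | succ n ih =>
    rw [Function.iterate_succ_apply', pow_succ', mul_assoc]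
    exact (hFM _).trans (mul_le_mul_of_nonneg_left ih hM)

/-- Exact form of estimate (13) of the paper: general stability estimate for an
explicit scheme whose amplification coefficients satisfy `S_0 = 1` and
`S_ℓ = 0` for `1 ≤ ℓ ≤ r - 1`. -/
theorem general_scheme_stability
    {E : Type*} [NormedAddCommGroup E] [InnerProductSpace ℝ E]
    (F : E →ₗ[ℝ] E) (hF : ∀ x y : E, ⟪F x, y⟫ = -⟪x, F y⟫)
    (M : ℝ) (hM : 0 ≤ M) (hFM : ∀ x : E, ‖F x‖ ≤ M * ‖x‖)
    (k : ℕ) (α : ℕ → ℝ)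
    (S : ℕ → ℝ)
    (hS : ∀ ℓ : ℕ, ℓ ≤ k → S ℓ = ∑ j ∈ Finset.Icc (-(min ℓ (k - ℓ) : ℤ)) (min ℓ (k - ℓ) : ℤ),
      (-1 : ℝ) ^ j * α ((ℓ : ℤ) - j).toNat * α ((ℓ : ℤ) + j).toNat)
    (hS0 : S 0 = 1)
    (r : ℕ) (hr1 : 1 ≤ r) (hrk : r ≤ k)
    (hSvanish : ∀ ℓ : ℕ, 1 ≤ ℓ → ℓ ≤ r - 1 → S ℓ = 0)
    (K : ℝ) (hK : K = (1 / 2) * ∑ ℓ ∈ Finset.Icc r k, |S ℓ|)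
    (t : ℝ) (ht : 0 ≤ t) (htM : t * M ≤ 1) (x : E) :
    ‖∑ i ∈ Finset.range (k + 1), (α i * t ^ i) • (⇑F)^[i] x‖
      ≤ (1 + K * (t * M) ^ (2 * r)) * ‖x‖ := by
  have hK0 : 0 ≤ K := by rw [hK]; positivity
  have hc : 0 ≤ t * M := mul_nonneg ht hM
  refine abs_le_of_sq_le_sq' ?_ (by positivity) |>.2
  rw [norm_sq_sum_smul_iterate_of_skew hF]
  have hsplit : Finset.range (k + 1) = insert 0 (Finset.Icc 1 (r - 1) ∪ Finset.Icc r k) := by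
    ext l
    simp only [Finset.mem_range, Finset.mem_insert, Finset.mem_union, Finset.mem_Icc]
    omega
  have hdisj : Disjoint (Finset.Icc 1 (r - 1)) (Finset.Icc r k) := by
    rw [Finset.disjoint_left]
    intro l h₁ h₂
    rw [Finset.mem_Icc] at h₁ h₂
    omega
  have hterm (l : ℕ) (hl : l ∈ Finset.Icc r k) :
      S l * (t ^ (2 * l) * ‖(⇑F)^[l] x‖ ^ 2) ≤ |S l| * ((t * M) ^ (2 * r) * ‖x‖ ^ 2) := by
    have hpow : t ^ (2 * l) * ‖(⇑F)^[l] x‖ ^ 2 ≤ (t * M) ^ (2 * r) * ‖x‖ ^ 2 := calc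
      _ ≤ t ^ (2 * l) * (M ^ l * ‖x‖) ^ 2 := by
        gcongr
        exact norm_iterate_le_pow_mul hM hFM l x
      _ = (t * M) ^ (2 * l) * ‖x‖ ^ 2 := by ring
      _ ≤ _ := by
        gcongr ?_ * _
        exact pow_le_pow_of_le_one hc htM (by linarith [(Finset.mem_Icc.1 hl).1])
    exact mul_le_mul (le_abs_self _) hpow (by positivity) (abs_nonneg _)
  calc
    _ = ∑ l ∈ Finset.range (k + 1), S l * (t ^ (2 * l) * ‖(⇑F)^[l] x‖ ^ 2) :=
      Finset.sum_congr rfl fun l hl => by rw [hS l (by rw [Finset.mem_range] at hl; omega)]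
    _ = ‖x‖ ^ 2 + ∑ l ∈ Finset.Icc r k, S l * (t ^ (2 * l) * ‖(⇑F)^[l] x‖ ^ 2) := by
      rw [hsplit, Finset.sum_insert (by simp; omega), Finset.sum_union hdisj,
        Finset.sum_eq_zero (s := Finset.Icc 1 (r - 1)) fun l hl => by
          rw [hSvanish l (Finset.mem_Icc.1 hl).1 (Finset.mem_Icc.1 hl).2, zero_mul], hS0]
      simp
    _ ≤ ‖x‖ ^ 2 + ∑ l ∈ Finset.Icc r k, |S l| * ((t * M) ^ (2 * r) * ‖x‖ ^ 2) := by
      gcongr ‖x‖ ^ 2 + ?_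
      exact Finset.sum_le_sum hterm
    _ = ‖x‖ ^ 2 + 2 * (K * (t * M) ^ (2 * r)) * ‖x‖ ^ 2 := by
      rw [← Finset.sum_mul, hK]
      ring
    _ ≤ _ := by nlinarith [sq_nonneg (K * (t * M) ^ (2 * r) * ‖x‖)]
end

section
/- Let E be a real inner product space, F : E →ₗ[ℝ] E a linear map satisfying ⟨F x, y⟩ = −⟨x, F y⟩ for all x, y ∈ E with ‖F x‖ ≤ M ‖x‖ for all x (M ≥ 0), and G : E →ₗ[ℝ] E a linear map with ‖G x‖ ≤ A₁ ‖x‖ for all x (A₁ ≥ 0). Then for every t ≥ 0 and every x ∈ E, ‖x + t F x + t G x‖ ≤ (1 + (t M²/2 + A₁) t) ‖x‖. -/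
open RealInnerProductSpace

/-- A step along a vector orthogonal to `x` changes the norm only to second order. -/
theorem norm_add_smul_le_of_inner_eq_zero
    {E : Type*} [NormedAddCommGroup E] [InnerProductSpace ℝ E] {x v : E} (h : ⟪x, v⟫ = 0)
    {M : ℝ} (hv : ‖v‖ ≤ M * ‖x‖) (t : ℝ) :
    ‖x + t • v‖ ≤ (1 + t ^ 2 * M ^ 2 / 2) * ‖x‖ := by
  refine abs_le_of_sq_le_sq' ?_ (by positivity) |>.2
  have hv2 : ‖v‖ ^ 2 ≤ (M * ‖x‖) ^ 2 := pow_le_pow_left₀ (norm_nonneg v) hv 2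
  rw [norm_add_sq_real, inner_smul_right, h, norm_smul, mul_pow, Real.norm_eq_abs, sq_abs]
  nlinarith [mul_le_mul_of_nonneg_left hv2 (sq_nonneg t), sq_nonneg (t ^ 2 * M ^ 2 / 2 * ‖x‖)]

/-- Amplification estimate for the explicit Euler scheme applied to the
linearised incompressible Euler equations:
`‖x + t F x + t G x‖ ≤ (1 + (t M²/2 + A₁) t) ‖x‖`. -/
theorem euler_step_stability
    {E : Type*} [NormedAddCommGroup E] [InnerProductSpace ℝ E]
    (F : E →ₗ[ℝ] E) (hF : ∀ x y : E, ⟪F x, y⟫ = -⟪x, F y⟫)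
    (M : ℝ) (hM : 0 ≤ M) (hFM : ∀ x : E, ‖F x‖ ≤ M * ‖x‖)
    (G : E →ₗ[ℝ] E) (A₁ : ℝ) (hA₁ : 0 ≤ A₁) (hG : ∀ x : E, ‖G x‖ ≤ A₁ * ‖x‖)
    (t : ℝ) (ht : 0 ≤ t) (x : E) :
    ‖x + t • F x + t • G x‖ ≤ (1 + (t * M ^ 2 / 2 + A₁) * t) * ‖x‖ := by
  have hinner : ⟪x, F x⟫ = 0 := by
    have h := hF x x
    rw [real_inner_comm] at h
    linarith
  have hGx : ‖t • G x‖ ≤ t * (A₁ * ‖x‖) := by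
    rw [norm_smul, Real.norm_of_nonneg ht]
    exact mul_le_mul_of_nonneg_left (hG x) ht
  calc ‖x + t • F x + t • G x‖ ≤ ‖x + t • F x‖ + ‖t • G x‖ := norm_add_le _ _
    _ ≤ (1 + t ^ 2 * M ^ 2 / 2) * ‖x‖ + t * (A₁ * ‖x‖) :=
      add_le_add (norm_add_smul_le_of_inner_eq_zero hinner (hFM x) t) hGx
    _ = (1 + (t * M ^ 2 / 2 + A₁) * t) * ‖x‖ := by ring
end

section
/- Let E be a real inner product space, F : E →ₗ[ℝ] E a linear map satisfying ⟨F x, y⟩ = −⟨x, F y⟩ for all x, y ∈ E with ‖F x‖ ≤ M ‖x‖ for all x (M ≥ 0), and G : E →ₗ[ℝ] E a linear map with ‖G x‖ ≤ A₁ ‖x‖ for all x (A₁ ≥ 0). Then for every t ≥ 0 and every x ∈ E, ‖x + t F x + (t²/2) F(F x) + t G x‖ ≤ (1 + (t⁴ M⁴)/8 + t A₁) ‖x‖. -/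
open RealInnerProductSpace

/-- For skew-adjoint `F`, the second-order Taylor polynomial of `exp (t F)` satisfies
`‖x + t F x + (t²/2) F(F x)‖² = ‖x‖² + (t⁴/4) ‖F(F x)‖²`. -/
theorem norm_sq_taylor_two_of_skewAdjoint
    {E : Type*} [NormedAddCommGroup E] [InnerProductSpace ℝ E]
    (F : E →ₗ[ℝ] E) (hF : ∀ x y : E, ⟪F x, y⟫ = -⟪x, F y⟫) (t : ℝ) (x : E) :
    ‖x + t • F x + (t ^ 2 / 2) • F (F x)‖ ^ 2 = ‖x‖ ^ 2 + t ^ 4 / 4 * ‖F (F x)‖ ^ 2 := by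
  have skew (y : E) : ⟪y, F y⟫ = 0 := by
    have h := hF y y
    rw [real_inner_comm] at h
    linarith
  have hx := skew x
  have hFx := skew (F x)
  have hxFF : ⟪x, F (F x)⟫ = -‖F x‖ ^ 2 := by
    rw [← real_inner_self_eq_norm_sq, hF x (F x), neg_neg]
  rw [norm_add_sq_real, norm_add_sq_real, inner_add_left]
  simp only [real_inner_smul_left, real_inner_smul_right, norm_smul, mul_pow,
    Real.norm_eq_abs, sq_abs, hx, hFx, hxFF]
  ring

/-- Amplification estimate for the order-two centered scheme:
`‖x + t F x + (t²/2) F(F x) + t G x‖ ≤ (1 + t⁴M⁴/8 + t A₁) ‖x‖`. -/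
theorem centered_scheme_stability
    {E : Type*} [NormedAddCommGroup E] [InnerProductSpace ℝ E]
    (F : E →ₗ[ℝ] E) (hF : ∀ x y : E, ⟪F x, y⟫ = -⟪x, F y⟫)
    (M : ℝ) (hM : 0 ≤ M) (hFM : ∀ x : E, ‖F x‖ ≤ M * ‖x‖)
    (G : E →ₗ[ℝ] E) (A₁ : ℝ) (hA₁ : 0 ≤ A₁) (hG : ∀ x : E, ‖G x‖ ≤ A₁ * ‖x‖)
    (t : ℝ) (ht : 0 ≤ t) (x : E) :
    ‖x + t • F x + (t ^ 2 / 2) • F (F x) + t • G x‖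
      ≤ (1 + t ^ 4 * M ^ 4 / 8 + t * A₁) * ‖x‖ := by
  have hFF : ‖F (F x)‖ ≤ M ^ 2 * ‖x‖ := by
    calc ‖F (F x)‖ ≤ M * ‖F x‖ := hFM _
      _ ≤ M * (M * ‖x‖) := by gcongr; exact hFM x
      _ = M ^ 2 * ‖x‖ := by ring
  have hmain : ‖x + t • F x + (t ^ 2 / 2) • F (F x)‖ ≤ (1 + t ^ 4 * M ^ 4 / 8) * ‖x‖ := by
    refine (sq_le_sq₀ (norm_nonneg _) (by positivity)).mp ?_
    calc ‖x + t • F x + (t ^ 2 / 2) • F (F x)‖ ^ 2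
        = ‖x‖ ^ 2 + t ^ 4 / 4 * ‖F (F x)‖ ^ 2 := norm_sq_taylor_two_of_skewAdjoint F hF t x
      _ ≤ ‖x‖ ^ 2 + t ^ 4 / 4 * (M ^ 2 * ‖x‖) ^ 2 := by gcongr
      _ ≤ ((1 + t ^ 4 * M ^ 4 / 8) * ‖x‖) ^ 2 := by
        linarith [sq_nonneg (t ^ 4 * M ^ 4 / 8 * ‖x‖)]
  have hGx : ‖t • G x‖ ≤ t * (A₁ * ‖x‖) := by
    rw [norm_smul, Real.norm_of_nonneg ht]
    gcongr
    exact hG x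
  linarith [norm_add_le (x + t • F x + (t ^ 2 / 2) • F (F x)) (t • G x)]
end

section
/- Let A₀ > 0, δx > 0, C > 0, A₁ ≥ 0. Let E be a real inner product space, F : E →ₗ[ℝ] E a linear map satisfying ⟨F x, y⟩ = −⟨x, F y⟩ for all x, y ∈ E with ‖F x‖ ≤ (A₀/δx) ‖x‖ for all x, and G : E →ₗ[ℝ] E a linear map with ‖G x‖ ≤ A₁ ‖x‖ for all x. If 0 < δt ≤ 2 C^{1/3} (δx/A₀)^{4/3}, then for every x ∈ E, ‖x + δt F x + (δt²/2) F(F x) + δt G x‖ ≤ (1 + (C + A₁) δt) ‖x‖. -/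
open RealInnerProductSpace

/-- The condition `t ≤ 2 C^(1/3) r^(4/3)` in polynomial form. -/
theorem cube_le_of_le_two_mul_rpow {C r t : ℝ} (hC : 0 ≤ C) (hr : 0 ≤ r) (ht : 0 ≤ t)
    (h : t ≤ 2 * C ^ ((1 : ℝ) / 3) * r ^ ((4 : ℝ) / 3)) : t ^ 3 ≤ 8 * C * r ^ 4 := by
  have hC3 : (C ^ ((1 : ℝ) / 3)) ^ 3 = C := by
    rw [← Real.rpow_mul_natCast hC]
    norm_num
  have hr3 : (r ^ ((4 : ℝ) / 3)) ^ 3 = r ^ 4 := by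
    rw [← Real.rpow_mul_natCast hr, ← Real.rpow_natCast]
    norm_num
  calc t ^ 3 ≤ (2 * C ^ ((1 : ℝ) / 3) * r ^ ((4 : ℝ) / 3)) ^ 3 := by gcongr
    _ = 8 * C * r ^ 4 := by
      rw [mul_pow, mul_pow, hC3, hr3]
      norm_num

/-- Stability of the order-two centered scheme under the CFL-like condition
`δt ≤ 2 C^(1/3) (δx/A₀)^(4/3)`. -/
theorem centered_scheme_CFL
    (A₀ δx C A₁ : ℝ) (hA₀ : 0 < A₀) (hδx : 0 < δx) (hC : 0 < C) (hA₁ : 0 ≤ A₁)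
    {E : Type*} [NormedAddCommGroup E] [InnerProductSpace ℝ E]
    (F : E →ₗ[ℝ] E) (hF : ∀ x y : E, ⟪F x, y⟫ = -⟪x, F y⟫)
    (hFM : ∀ x : E, ‖F x‖ ≤ A₀ / δx * ‖x‖)
    (G : E →ₗ[ℝ] E) (hG : ∀ x : E, ‖G x‖ ≤ A₁ * ‖x‖)
    (δt : ℝ) (hδt : 0 < δt)
    (hCFL : δt ≤ 2 * C ^ ((1 : ℝ) / 3) * (δx / A₀) ^ ((4 : ℝ) / 3))
    (x : E) :
    ‖x + δt • F x + (δt ^ 2 / 2) • F (F x) + δt • G x‖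
      ≤ (1 + (C + A₁) * δt) * ‖x‖ := by
  have cube_le := cube_le_of_le_two_mul_rpow hC.le (by positivity) hδt.le hCFL
  have defect_le : δt ^ 4 / 4 * (A₀ / δx) ^ 4 ≤ 2 * C * δt := by
    calc δt ^ 4 / 4 * (A₀ / δx) ^ 4 = δt / 4 * (A₀ / δx) ^ 4 * δt ^ 3 := by ring
      _ ≤ δt / 4 * (A₀ / δx) ^ 4 * (8 * C * (δx / A₀) ^ 4) := by gcongr
      _ = 2 * C * δt := by
        field_simp
        norm_num
  have norm_FF_le : ‖F (F x)‖ ≤ (A₀ / δx) ^ 2 * ‖x‖ := by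
    calc ‖F (F x)‖ ≤ A₀ / δx * ‖F x‖ := hFM _
      _ ≤ A₀ / δx * (A₀ / δx * ‖x‖) := by gcongr; exact hFM x
      _ = (A₀ / δx) ^ 2 * ‖x‖ := by ring
  have advection_le : ‖x + δt • F x + (δt ^ 2 / 2) • F (F x)‖ ≤ (1 + C * δt) * ‖x‖ := by
    refine (sq_le_sq₀ (norm_nonneg _) (by positivity)).mp ?_
    rw [norm_sq_taylor_two_of_skewAdjoint F hF]
    calc ‖x‖ ^ 2 + δt ^ 4 / 4 * ‖F (F x)‖ ^ 2
        ≤ ‖x‖ ^ 2 + δt ^ 4 / 4 * ((A₀ / δx) ^ 2 * ‖x‖) ^ 2 := by gcongr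
      _ = ‖x‖ ^ 2 + δt ^ 4 / 4 * (A₀ / δx) ^ 4 * ‖x‖ ^ 2 := by ring
      _ ≤ ‖x‖ ^ 2 + 2 * C * δt * ‖x‖ ^ 2 := by gcongr
      _ ≤ ((1 + C * δt) * ‖x‖) ^ 2 := by
        linarith [sq_nonneg (C * δt * ‖x‖)]
  calc ‖x + δt • F x + (δt ^ 2 / 2) • F (F x) + δt • G x‖
      ≤ ‖x + δt • F x + (δt ^ 2 / 2) • F (F x)‖ + ‖δt • G x‖ := norm_add_le _ _
    _ ≤ (1 + C * δt) * ‖x‖ + δt * (A₁ * ‖x‖) := by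
      rw [norm_smul, Real.norm_of_nonneg hδt.le]
      gcongr
      exact hG x
    _ = (1 + (C + A₁) * δt) * ‖x‖ := by ring
end

section
/- Let E be a real inner product space and F : E →ₗ[ℝ] E a linear map satisfying ⟨F x, y⟩ = −⟨x, F y⟩ for all x, y ∈ E. Then for all t ∈ ℝ and x ∈ E, ‖Σ_{i=0}^{4} (t^i / i!) F^[i] x‖² = ‖x‖² − (t⁶/72) ‖F^[3] x‖² + (t⁸/576) ‖F^[4] x‖². -/
open RealInnerProductSpace

theorem inner_map_self_eq_zero_of_skewAdjoint
    {E : Type*} [NormedAddCommGroup E] [InnerProductSpace ℝ E]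
    {F : E →ₗ[ℝ] E} (hF : ∀ x y : E, ⟪F x, y⟫ = -⟪x, F y⟫) (x : E) : ⟪x, F x⟫ = 0 := by
  have h := hF x x
  rw [real_inner_comm] at h
  linarith

/-- Amplification norm identity for the classical fourth-order Runge–Kutta
scheme applied to a skew-adjoint operator: `S₁ = S₂ = 0`, `S₃ = -1/72`,
`S₄ = 1/576`. -/
theorem rk4_norm_sq
    {E : Type*} [NormedAddCommGroup E] [InnerProductSpace ℝ E]
    (F : E →ₗ[ℝ] E) (hF : ∀ x y : E, ⟪F x, y⟫ = -⟪x, F y⟫)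
    (t : ℝ) (x : E) :
    ‖∑ i ∈ Finset.range 5, (t ^ i / (i.factorial : ℝ)) • (⇑F)^[i] x‖ ^ 2
      = ‖x‖ ^ 2 - t ^ 6 / 72 * ‖(⇑F)^[3] x‖ ^ 2 + t ^ 8 / 576 * ‖(⇑F)^[4] x‖ ^ 2 := by
  have h_orth := inner_map_self_eq_zero_of_skewAdjoint hF
  have h_skew : ∀ y z : E, ⟪y, F z⟫ = -⟪F y, z⟫ := fun y z => by rw [hF, neg_neg]
  have h_two : ∀ y : E, ⟪y, F (F y)⟫ = -⟪F y, F y⟫ := fun y => h_skew y (F y)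
  have h_three : ∀ y : E, ⟪y, F (F (F y))⟫ = 0 := fun y => by
    rw [h_skew, h_orth, neg_zero]
  have h_four : ∀ y : E, ⟪y, F (F (F (F y)))⟫ = ⟪F (F y), F (F y)⟫ := fun y => by
    rw [h_skew, h_two, neg_neg]
  simp only [Finset.sum_range_succ, Finset.sum_range_zero, Function.iterate_succ,
    Function.iterate_zero, Function.comp_apply, id_eq, zero_add, Nat.factorial,
    ← real_inner_self_eq_norm_sq, inner_add_left, inner_add_right, real_inner_smul_left,
    real_inner_smul_right]
  rw [real_inner_comm x (F x), real_inner_comm x (F (F x)), real_inner_comm x (F (F (F x))),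
    real_inner_comm x (F (F (F (F x)))), real_inner_comm (F x) (F (F x)),
    real_inner_comm (F x) (F (F (F x))), real_inner_comm (F x) (F (F (F (F x)))),
    real_inner_comm (F (F x)) (F (F (F x))), real_inner_comm (F (F x)) (F (F (F (F x)))),
    real_inner_comm (F (F (F x))) (F (F (F (F x))))]
  simp only [h_orth, h_three, h_four, h_two]
  push_cast
  ring
end
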